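/- arXiv:2603.14048 — 4 statements merged into one kernel-verified Lean document; each statement's English description precedes it below -/
import Mathlib

section
/- Let m, n ≥ 2 be integers. The Seidel matrix S(m,n) of the complete 3-uniform bipartite hypergraph C^3_{m,n} has exactly one negative eigenvalue, and its remaining m+n-1 eigenvalues (counted with multiplicity) are all positive. -/
open Polynomial Matrix

/-- The Seidel matrix of the complete 3-uniform bipartite hypergraph `C³_{m,n}`. -/
noncomputable def seidelS (m n : ℕ) : Matrix (Fin m ⊕ Fin n) (Fin m ⊕ Fin n) ℝ :=
  fun i j =>
    if i = j then 0
    else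
      match i, j with
      | Sum.inl _, Sum.inl _ => 1 - 2 * (n : ℝ)
      | Sum.inr _, Sum.inr _ => 1 - 2 * (m : ℝ)
      | _, _ => 1 - 2 * ((m : ℝ) + (n : ℝ) - 2)

/-- Type-I hyperedge-deleted Seidel matrix. -/
noncomputable def seidelI (m n : ℕ) : Matrix (Fin m ⊕ Fin n) (Fin m ⊕ Fin n) ℝ :=
  fun i j =>
    match i, j with
    | Sum.inl a, Sum.inr b =>
        if a.val = 0 ∧ b.val ≤ 1 then 1 - 2 * ((m : ℝ) + (n : ℝ) - 3)
        else seidelS m n (Sum.inl a) (Sum.inr b)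
    | Sum.inr b, Sum.inl a =>
        if a.val = 0 ∧ b.val ≤ 1 then 1 - 2 * ((m : ℝ) + (n : ℝ) - 3)
        else seidelS m n (Sum.inr b) (Sum.inl a)
    | Sum.inr a, Sum.inr b =>
        if (a.val = 0 ∧ b.val = 1) ∨ (a.val = 1 ∧ b.val = 0) then 1 - 2 * ((m : ℝ) - 1)
        else seidelS m n (Sum.inr a) (Sum.inr b)
    | Sum.inl a, Sum.inl b => seidelS m n (Sum.inl a) (Sum.inl b)

/-- Type-II hyperedge-deleted Seidel matrix. -/
noncomputable def seidelII (m n : ℕ) : Matrix (Fin m ⊕ Fin n) (Fin m ⊕ Fin n) ℝ :=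
  fun i j =>
    match i, j with
    | Sum.inl a, Sum.inl b =>
        if (a.val = 0 ∧ b.val = 1) ∨ (a.val = 1 ∧ b.val = 0) then 1 - 2 * ((n : ℝ) - 1)
        else seidelS m n (Sum.inl a) (Sum.inl b)
    | Sum.inl a, Sum.inr b =>
        if a.val ≤ 1 ∧ b.val = 0 then 1 - 2 * ((m : ℝ) + (n : ℝ) - 3)
        else seidelS m n (Sum.inl a) (Sum.inr b)
    | Sum.inr b, Sum.inl a =>
        if a.val ≤ 1 ∧ b.val = 0 then 1 - 2 * ((m : ℝ) + (n : ℝ) - 3)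
        else seidelS m n (Sum.inr b) (Sum.inl a)
    | Sum.inr a, Sum.inr b => seidelS m n (Sum.inr a) (Sum.inr b)

/-- Seidel energy: sum of absolute values of the eigenvalues (roots of the
characteristic polynomial, with multiplicity). -/
noncomputable def seidelEnergy {k : Type*} [Fintype k] [DecidableEq k]
    (M : Matrix k k ℝ) : ℝ :=
  (M.charpoly.roots.map (fun x => |x|)).sum

theorem Matrix.IsHermitian.eigenvalues_pos_of_eigenvalues_nonpos {ι : Type*} [Fintype ι]
    [DecidableEq ι] {A : Matrix ι ι ℝ} (hA : A.IsHermitian) (l : ι → ℝ)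
    (hpos : ∀ w : ι → ℝ, w ≠ 0 → l ⬝ᵥ w = 0 → 0 < w ⬝ᵥ (A *ᵥ w)) {i j : ι} (hij : j ≠ i)
    (hi : hA.eigenvalues i ≤ 0) : 0 < hA.eigenvalues j := by
  by_contra! hj
  have horth : ∀ p q, (hA.eigenvectorBasis p).ofLp ⬝ᵥ (hA.eigenvectorBasis q).ofLp
      = if p = q then 1 else 0 := fun p q => by
    have h := orthonormal_iff_ite.1 hA.eigenvectorBasis.orthonormal p q
    rw [EuclideanSpace.inner_eq_star_dotProduct, dotProduct_comm] at h
    simpa using h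
  have key : ∀ α β : ℝ, (α ≠ 0 ∨ β ≠ 0) → α * (l ⬝ᵥ (hA.eigenvectorBasis i).ofLp)
      + β * (l ⬝ᵥ (hA.eigenvectorBasis j).ofLp) = 0 → False := fun α β hαβ hl => by
    set u : ι → ℝ := (hA.eigenvectorBasis i).ofLp with hu
    set v : ι → ℝ := (hA.eigenvectorBasis j).ofLp with hv
    have huu : u ⬝ᵥ u = 1 := by simpa using horth i i
    have hvv : v ⬝ᵥ v = 1 := by simpa using horth j j
    have huv : u ⬝ᵥ v = 0 := by simpa [hij.symm] using horth i j
    have hvu : v ⬝ᵥ u = 0 := by simpa [hij] using horth j i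
    have hw : α • u + β • v ≠ 0 := fun h => by
      have h1 : u ⬝ᵥ (α • u + β • v) = α := by simp [dotProduct_add, huu, huv]
      have h2 : v ⬝ᵥ (α • u + β • v) = β := by simp [dotProduct_add, hvu, hvv]
      rw [h, dotProduct_zero] at h1 h2
      exact hαβ.elim (fun h => h h1.symm) (fun h => h h2.symm)
    have hq := hpos _ hw (by simpa [dotProduct_add] using hl)
    have hAu : A *ᵥ u = hA.eigenvalues i • u := hA.mulVec_eigenvectorBasis i
    have hAv : A *ᵥ v = hA.eigenvalues j • v := hA.mulVec_eigenvectorBasis j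
    simp only [mulVec_add, mulVec_smul, hAu, hAv, dotProduct_add, add_dotProduct,
      smul_dotProduct, dotProduct_smul, huu, hvv, huv, hvu, smul_eq_mul] at hq
    nlinarith [mul_nonneg (sq_nonneg α) (neg_nonneg.2 hi),
      mul_nonneg (sq_nonneg β) (neg_nonneg.2 hj)]
  by_cases h : l ⬝ᵥ (hA.eigenvectorBasis i).ofLp = 0
  · exact key 1 0 (by simp) (by simp [h])
  · exact key (-(l ⬝ᵥ (hA.eigenvectorBasis j).ofLp)) _ (Or.inr h) (by ring)

theorem Matrix.IsHermitian.card_roots_charpoly_of_trace_eq_zero {ι : Type*} [Fintype ι]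
    [DecidableEq ι] [Nontrivial ι] {A : Matrix ι ι ℝ} (hA : A.IsHermitian)
    (htr : A.trace = 0) (l : ι → ℝ)
    (hpos : ∀ w : ι → ℝ, w ≠ 0 → l ⬝ᵥ w = 0 → 0 < w ⬝ᵥ (A *ᵥ w)) :
    (A.charpoly.roots.filter (fun x => x < 0)).card = 1 ∧
    (A.charpoly.roots.filter (fun x => 0 < x)).card = Fintype.card ι - 1 := by
  have hsum : ∑ i, hA.eigenvalues i = 0 := by
    simpa [htr] using hA.trace_eq_sum_eigenvalues.symm
  obtain ⟨i, hi⟩ : ∃ i, hA.eigenvalues i < 0 := by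
    by_contra! h
    have h0 := (Finset.sum_eq_zero_iff_of_nonneg fun i _ => h i).1 hsum
    obtain ⟨i, j, hij⟩ := exists_pair_ne ι
    have := hA.eigenvalues_pos_of_eigenvalues_nonpos l hpos hij (h0 j (Finset.mem_univ j)).le
    exact this.ne' (h0 i (Finset.mem_univ i))
  have hj : ∀ j, j ≠ i → 0 < hA.eigenvalues j := fun j hji =>
    hA.eigenvalues_pos_of_eigenvalues_nonpos l hpos hji hi.le
  have hneg : Finset.univ.filter (fun j => hA.eigenvalues j < 0) = {i} := by
    ext j
    by_cases h : j = i
    · simp [h, hi]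
    · simp [h, (hj j h).le]
  have hposf : Finset.univ.filter (fun j => 0 < hA.eigenvalues j) = Finset.univ.erase i := by
    ext j
    by_cases h : j = i
    · simp [h, hi.le]
    · simp [h, hj j h]
  rw [hA.roots_charpoly_eq_eigenvalues]
  simp only [Multiset.filter_map, Multiset.card_map]
  constructor
  · exact (congrArg Finset.card hneg).trans (Finset.card_singleton i)
  · exact (congrArg Finset.card hposf).trans (by simp [Finset.card_erase_of_mem])

theorem seidelS_isHermitian (m n : ℕ) : (seidelS m n).IsHermitian := by
  ext i j
  rcases i with i | i <;> rcases j with j | j <;> simp [seidelS, eq_comm]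

theorem seidelS_trace (m n : ℕ) : (seidelS m n).trace = 0 := by
  simp [Matrix.trace, seidelS]

theorem seidelS_mulVec_inl (m n : ℕ) (w : Fin m ⊕ Fin n → ℝ) (i : Fin m) :
    (seidelS m n *ᵥ w) (Sum.inl i) = (2 * n - 1) * w (Sum.inl i)
      - (2 * n - 1) * ∑ k, w (Sum.inl k) - (2 * m + 2 * n - 5) * ∑ k, w (Sum.inr k) := by
  have h : ∀ k, seidelS m n (Sum.inl i) (Sum.inl k) * w (Sum.inl k)
      = (if i = k then (2 * n - 1) * w (Sum.inl k) else 0) - (2 * n - 1) * w (Sum.inl k) :=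
    fun k => by by_cases hk : i = k <;> simp [seidelS, hk]; ring
  simp only [mulVec, dotProduct, Fintype.sum_sum_type, h, Finset.sum_sub_distrib]
  simp only [seidelS, reduceCtorEq, if_false, Finset.sum_ite_eq, Finset.mem_univ, if_true,
    ← Finset.mul_sum]
  ring

theorem seidelS_mulVec_inr (m n : ℕ) (w : Fin m ⊕ Fin n → ℝ) (i : Fin n) :
    (seidelS m n *ᵥ w) (Sum.inr i) = (2 * m - 1) * w (Sum.inr i)
      - (2 * m - 1) * ∑ k, w (Sum.inr k) - (2 * m + 2 * n - 5) * ∑ k, w (Sum.inl k) := by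
  have h : ∀ k, seidelS m n (Sum.inr i) (Sum.inr k) * w (Sum.inr k)
      = (if i = k then (2 * m - 1) * w (Sum.inr k) else 0) - (2 * m - 1) * w (Sum.inr k) :=
    fun k => by by_cases hk : i = k <;> simp [seidelS, hk]; ring
  simp only [mulVec, dotProduct, Fintype.sum_sum_type, h, Finset.sum_sub_distrib]
  simp only [seidelS, reduceCtorEq, if_false, Finset.sum_ite_eq, Finset.mem_univ, if_true,
    ← Finset.mul_sum]
  ring

theorem dotProduct_seidelS_mulVec (m n : ℕ) (w : Fin m ⊕ Fin n → ℝ) :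
    w ⬝ᵥ (seidelS m n *ᵥ w) =
      (2 * n - 1) * ∑ k, w (Sum.inl k) ^ 2 + (2 * m - 1) * ∑ k, w (Sum.inr k) ^ 2
      - ((2 * n - 1) * (∑ k, w (Sum.inl k)) ^ 2
        + 2 * (2 * m + 2 * n - 5) * (∑ k, w (Sum.inl k)) * ∑ k, w (Sum.inr k)
        + (2 * m - 1) * (∑ k, w (Sum.inr k)) ^ 2) := by
  simp only [dotProduct, Fintype.sum_sum_type, seidelS_mulVec_inl, seidelS_mulVec_inr, mul_sub,
    Finset.sum_sub_distrib, ← Finset.sum_mul, mul_left_comm (w _), ← Finset.mul_sum, ← pow_two]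
  ring

theorem dotProduct_seidelS_mulVec_pos {m n : ℕ} (hm : 2 ≤ m) (hn : 2 ≤ n)
    (w : Fin m ⊕ Fin n → ℝ) (hw : w ≠ 0)
    (hl : Sum.elim (fun _ => 2 * (n : ℝ) - 1) (fun _ => 2 * (m : ℝ) + 2 * n - 5) ⬝ᵥ w = 0) :
    0 < w ⬝ᵥ (seidelS m n *ᵥ w) := by
  have hm' : (2 : ℝ) ≤ m := by exact_mod_cast hm
  have hn' : (2 : ℝ) ≤ n := by exact_mod_cast hn
  simp only [dotProduct, Fintype.sum_sum_type, Sum.elim_inl, Sum.elim_inr,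
    ← Finset.mul_sum] at hl
  rw [dotProduct_seidelS_mulVec]
  set s := ∑ k, w (Sum.inl k)
  set t := ∑ k, w (Sum.inr k)
  have hdiag : 0 < (2 * (n : ℝ) - 1) * ∑ k, w (Sum.inl k) ^ 2
      + (2 * m - 1) * ∑ k, w (Sum.inr k) ^ 2 := by
    have h1 : 0 ≤ ∑ k, w (Sum.inl k) ^ 2 := by positivity
    have h2 : 0 ≤ ∑ k, w (Sum.inr k) ^ 2 := by positivity
    have h3 : 0 < ∑ k, w (Sum.inl k) ^ 2 + ∑ k, w (Sum.inr k) ^ 2 := by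
      rw [← Fintype.sum_sum_type (fun k => w k ^ 2)]
      obtain ⟨k, hk⟩ := Function.ne_iff.1 hw
      exact Finset.sum_pos' (fun i _ => sq_nonneg _) ⟨k, Finset.mem_univ k, by
        have : w k ≠ 0 := hk
        positivity⟩
    nlinarith
  have hcross : (2 * (n : ℝ) - 1) * s ^ 2 + 2 * (2 * m + 2 * n - 5) * s * t
      + (2 * m - 1) * t ^ 2 ≤ 0 := by
    have hdet : (2 * (n : ℝ) - 1) * (2 * m - 1) ≤ (2 * m + 2 * n - 5) ^ 2 := by
      nlinarith [mul_nonneg (sub_nonneg.2 hm') (sub_nonneg.2 hn')]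
    have hmul : (2 * (n : ℝ) - 1) * ((2 * (n : ℝ) - 1) * s ^ 2
        + 2 * (2 * m + 2 * n - 5) * s * t + (2 * m - 1) * t ^ 2)
        = ((2 * (n : ℝ) - 1) * (2 * m - 1) - (2 * m + 2 * n - 5) ^ 2) * t ^ 2 := by
      linear_combination ((2 * (n : ℝ) - 1) * s + (2 * m + 2 * n - 5) * t) * hl
    refine nonpos_of_mul_nonpos_right ?_ (by linarith : 0 < 2 * (n : ℝ) - 1)
    rw [hmul]
    exact mul_nonpos_of_nonpos_of_nonneg (by linarith) (sq_nonneg t)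
  linarith

theorem stmt2 (m n : ℕ) (hm : 2 ≤ m) (hn : 2 ≤ n) :
    ((seidelS m n).charpoly.roots.filter (fun x => x < 0)).card = 1 ∧
    ((seidelS m n).charpoly.roots.filter (fun x => 0 < x)).card = m + n - 1 := by
  have : Nontrivial (Fin m ⊕ Fin n) :=
    ⟨Sum.inl ⟨0, by omega⟩, Sum.inr ⟨0, by omega⟩, Sum.inl_ne_inr⟩
  simpa using (seidelS_isHermitian m n).card_roots_charpoly_of_trace_eq_zero
    (seidelS_trace m n) _ (dotProduct_seidelS_mulVec_pos hm hn)
end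

section
/- Let m ≥ 2 and n ≥ 3 be integers. The characteristic polynomial of the Type-I hyperedge-deleted Seidel matrix S_I(m,n) equals (X-(2n-1))^(m-2) · (X-(2m-1))^(n-3) · p_Q1(X), where p_Q1 is the characteristic polynomial of the 5×5 real matrix Q1 with rows: [0, 1-2(m+n-3), 1-2(m+n-3), (m-1)(1-2n), (n-2)(1-2(m+n-2))]; [1-2(m+n-3), 0, 1-2(m-1), (m-1)(1-2(m+n-2)), (n-2)(1-2m)]; [1-2(m+n-3), 1-2(m-1), 0, (m-1)(1-2(m+n-2)), (n-2)(1-2m)]; [1-2n, 1-2(m+n-2), 1-2(m+n-2), (m-2)(1-2n), (n-2)(1-2(m+n-2))]; [1-2(m+n-2), 1-2m, 1-2m, (m-1)(1-2(m+n-2)), (n-3)(1-2m)]. Consequently the Seidel spectrum of C^3_{m,n} - e (Type-I deletion) is 2n-1 with multiplicity m-2, 2m-1 with multiplicity n-3, together with the five eigenvalues of Q1. -/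
open Polynomial Matrix

/-- The 5×5 quotient matrix for the Type-I hyperedge deletion. -/
noncomputable def Q1 (m n : ℕ) : Matrix (Fin 5) (Fin 5) ℝ :=
  !![0, 1 - 2*((m:ℝ)+n-3), 1 - 2*((m:ℝ)+n-3), ((m:ℝ)-1)*(1-2*n), ((n:ℝ)-2)*(1-2*((m:ℝ)+n-2));
     1 - 2*((m:ℝ)+n-3), 0, 1 - 2*((m:ℝ)-1), ((m:ℝ)-1)*(1-2*((m:ℝ)+n-2)), ((n:ℝ)-2)*(1-2*m);
     1 - 2*((m:ℝ)+n-3), 1 - 2*((m:ℝ)-1), 0, ((m:ℝ)-1)*(1-2*((m:ℝ)+n-2)), ((n:ℝ)-2)*(1-2*m);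
     1 - 2*(n:ℝ), 1 - 2*((m:ℝ)+n-2), 1 - 2*((m:ℝ)+n-2), ((m:ℝ)-2)*(1-2*n), ((n:ℝ)-2)*(1-2*((m:ℝ)+n-2));
     1 - 2*((m:ℝ)+n-2), 1 - 2*(m:ℝ), 1 - 2*(m:ℝ), ((m:ℝ)-1)*(1-2*((m:ℝ)+n-2)), ((n:ℝ)-3)*(1-2*m)]

/-- The determinant of a diagonal matrix minus a matrix, both constant along the fibres of `c`. -/
theorem det_diagonal_comp_sub_submatrix {ι κ K : Type*} [Fintype ι] [DecidableEq ι] [Fintype κ]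
    [DecidableEq κ] [Field K] (c : ι → κ) (hc : Function.Surjective c) (e : κ → K)
    (he : ∀ k, e k ≠ 0) (B : Matrix κ κ K) :
    (diagonal (e ∘ c) - B.submatrix c c).det =
      (∏ k, e k ^ (Fintype.card {i // c i = k} - 1)) *
        (diagonal e - B * diagonal fun k => (Fintype.card {i // c i = k} : K)).det := by
  set N : κ → K := fun k => (Fintype.card {i // c i = k} : K) with hN
  let U : Matrix ι κ K := (1 : Matrix κ κ K).submatrix c id
  let V : Matrix κ ι K := of fun k j => B k (c j) * (e (c j))⁻¹
  have h_left : diagonal (e ∘ c) - B.submatrix c c = (1 - U * V) * diagonal (e ∘ c) := by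
    have : U * V * diagonal (e ∘ c) = B.submatrix c c := by
      ext i j
      rw [mul_diagonal, mul_apply]
      simp [U, V, one_apply, he]
    rw [sub_mul, one_mul, this]
  have h_right : (1 - V * U) * diagonal e = diagonal e - B * diagonal N := by
    have : V * U * diagonal e = B * diagonal N := by
      ext k l
      rw [mul_diagonal, mul_diagonal, mul_apply]
      simp only [U, V, hN, one_apply, submatrix_apply, id_eq, of_apply, mul_ite, mul_one,
        mul_zero, ← Finset.sum_filter, Fintype.card_subtype]
      rw [Finset.sum_congr rfl (g := fun _ => B k l * (e l)⁻¹) (by simp +contextual)]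
      have := he l
      rw [Finset.sum_const, nsmul_eq_mul]
      field_simp
    rw [sub_mul, one_mul, this]
  have h_prod : ∏ i, e (c i) = (∏ k, e k ^ (Fintype.card {i // c i = k} - 1)) * ∏ k, e k := by
    rw [← Finset.prod_mul_distrib, ← Finset.prod_fiberwise (g := c)]
    refine Finset.prod_congr rfl fun k _ => ?_
    rw [Finset.prod_congr rfl (g := fun _ => e k) (by simp +contextual), Finset.prod_const,
      ← Fintype.card_subtype, ← pow_succ, Nat.sub_add_cancel]
    obtain ⟨i, hi⟩ := hc k
    exact Fintype.card_pos_iff.2 ⟨⟨i, hi⟩⟩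
  rw [h_left, ← h_right, det_mul, det_mul, det_diagonal, det_diagonal, det_one_sub_mul_comm]
  simp only [Function.comp_apply, h_prod]
  ring

/-- The characteristic polynomial of a matrix with an equitable partition into blocks that are
constant up to a multiple of the identity, in terms of the quotient matrix. -/
theorem charpoly_diagonal_comp_add_submatrix {ι κ K : Type*} [Fintype ι] [DecidableEq ι]
    [Fintype κ] [DecidableEq κ] [Field K] [Infinite K] (c : ι → κ) (hc : Function.Surjective c)
    (d : κ → K) (B : Matrix κ κ K) :
    (diagonal (d ∘ c) + B.submatrix c c).charpoly =
      (∏ k, (X - C (d k)) ^ (Fintype.card {i // c i = k} - 1)) *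
        (diagonal d + B * diagonal fun k => (Fintype.card {i // c i = k} : K)).charpoly := by
  refine Polynomial.eq_of_infinite_eval_eq _ _
    ((Set.finite_range d).infinite_compl.mono fun t ht => ?_)
  have h := det_diagonal_comp_sub_submatrix c hc (fun k => t - d k)
    (fun k hk => ht ⟨k, (sub_eq_zero.1 hk).symm⟩) B
  simp only [Set.mem_ofPred_eq, eval_mul, eval_charpoly, eval_prod, eval_pow, eval_sub, eval_X,
    eval_C]
  rw [scalar_apply, scalar_apply, ← sub_sub, diagonal_sub, ← sub_sub, diagonal_sub, ← h]
  rfl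

/-- The equitable partition of the vertices of the Type-I hyperedge-deleted hypergraph. -/
def typeIClass (m n : ℕ) : Fin m ⊕ Fin n → Fin 5
  | Sum.inl a => if a.val = 0 then 0 else 3
  | Sum.inr b => if b.val = 0 then 1 else if b.val = 1 then 2 else 4

theorem card_typeIClass (m n : ℕ) (k : Fin 5) :
    Fintype.card {i // typeIClass (m + 2) (n + 3) i = k} = ![1, 1, 1, m + 1, n + 1] k := by
  rw [Fintype.card_subtype, Finset.card_filter, Fintype.sum_sum_type, Fin.sum_univ_succ,
    Fin.sum_univ_succ (n := n + 2), Fin.sum_univ_succ (n := n + 1)]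
  fin_cases k <;> simp [typeIClass]

theorem typeIClass_surjective (m n : ℕ) : Function.Surjective (typeIClass (m + 2) (n + 3)) := by
  intro k
  have h : 0 < Fintype.card {i // typeIClass (m + 2) (n + 3) i = k} := by
    rw [card_typeIClass]
    fin_cases k <;> simp
  obtain ⟨i, hi⟩ := Fintype.card_pos_iff.1 h
  exact ⟨i, hi⟩

/-- The diagonal shift of the Type-I matrix on each class. -/
noncomputable def typeIShift (m n : ℕ) : Fin 5 → ℝ :=
  ![0, 0, 0, 2 * (n : ℝ) - 1, 2 * (m : ℝ) - 1]

/-- The block values of the Type-I matrix. -/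
noncomputable def typeIBlock (m n : ℕ) : Matrix (Fin 5) (Fin 5) ℝ :=
  let p : ℝ := 1 - 2 * n
  let q : ℝ := 1 - 2 * m
  let r : ℝ := 1 - 2 * (m + n - 2)
  let s : ℝ := 1 - 2 * (m + n - 3)
  let u : ℝ := 1 - 2 * (m - 1)
  !![0, s, s, p, r;
     s, 0, u, r, q;
     s, u, 0, r, q;
     p, r, r, p, r;
     r, q, q, r, q]

theorem seidelI_eq_diagonal_add_submatrix (m n : ℕ) :
    seidelI m n = diagonal (typeIShift m n ∘ typeIClass m n) +
      (typeIBlock m n).submatrix (typeIClass m n) (typeIClass m n) := by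
  ext i j
  rcases i with a | a <;> rcases j with b | b <;>
    simp only [seidelI, seidelS, typeIClass, Matrix.add_apply, diagonal_apply, submatrix_apply,
      Function.comp_apply, Sum.inl.injEq, Sum.inr.injEq, reduceCtorEq, if_false,
      Fin.ext_iff] <;>
    split_ifs <;> first | omega | simp [typeIShift, typeIBlock]

theorem Q1_eq_diagonal_add_mul (m n : ℕ) :
    Q1 (m + 2) (n + 3) = diagonal (typeIShift (m + 2) (n + 3)) +
      typeIBlock (m + 2) (n + 3) * diagonal fun k =>
        (Fintype.card {i // typeIClass (m + 2) (n + 3) i = k} : ℝ) := by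
  simp only [card_typeIClass]
  ext i j
  rw [Matrix.add_apply, mul_diagonal]
  fin_cases i <;> fin_cases j <;> simp [Q1, typeIShift, typeIBlock] <;> ring

theorem stmt4 (m n : ℕ) (hm : 2 ≤ m) (hn : 3 ≤ n) :
    (seidelI m n).charpoly =
      (X - C (2*(n:ℝ) - 1)) ^ (m - 2) * (X - C (2*(m:ℝ) - 1)) ^ (n - 3) *
        (Q1 m n).charpoly ∧
    (seidelI m n).charpoly.roots =
      Multiset.replicate (m - 2) (2*(n:ℝ) - 1) +
      Multiset.replicate (n - 3) (2*(m:ℝ) - 1) +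
      (Q1 m n).charpoly.roots := by
  have h_charpoly : (seidelI m n).charpoly =
      (X - C (2*(n:ℝ) - 1)) ^ (m - 2) * (X - C (2*(m:ℝ) - 1)) ^ (n - 3) *
        (Q1 m n).charpoly := by
    obtain ⟨m, rfl⟩ := Nat.exists_eq_add_of_le' hm
    obtain ⟨n, rfl⟩ := Nat.exists_eq_add_of_le' hn
    rw [seidelI_eq_diagonal_add_submatrix,
      charpoly_diagonal_comp_add_submatrix _ (typeIClass_surjective m n),
      ← Q1_eq_diagonal_add_mul]
    simp [card_typeIClass, Fin.prod_univ_five, typeIShift]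
  refine ⟨h_charpoly, ?_⟩
  have h_left := (monic_X_sub_C (2*(n:ℝ) - 1)).pow (m - 2)
  have h_right := (monic_X_sub_C (2*(m:ℝ) - 1)).pow (n - 3)
  rw [h_charpoly,
    roots_mul ((h_left.mul h_right).mul (charpoly_monic (Q1 m n))).ne_zero,
    roots_mul (h_left.mul h_right).ne_zero]
  simp only [roots_pow, roots_X_sub_C, Multiset.nsmul_singleton]
end

section
/- Let m, n ≥ 3 be integers. The smallest eigenvalue of the Seidel matrix S(m,n) of C^3_{m,n} is strictly smaller than the smallest eigenvalue of the Type-I hyperedge-deleted Seidel matrix S_I(m,n). (Equivalently, the unique positive eigenvalue of -S(m,n) strictly exceeds the unique positive eigenvalue of -S_I(m,n).) -/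
open Polynomial Matrix

/-- A real number is a root of the characteristic polynomial iff it is a right eigenvalue. -/
theorem mem_roots_charpoly_iff_exists_mulVec {k : Type*} [Fintype k] [DecidableEq k]
    (M : Matrix k k ℝ) (t : ℝ) :
    t ∈ M.charpoly.roots ↔ ∃ x ≠ 0, M *ᵥ x = t • x := by
  rw [mem_roots M.charpoly_monic.ne_zero, IsRoot.def, Matrix.eval_charpoly,
    ← Matrix.exists_mulVec_eq_zero_iff]
  simp only [Matrix.sub_mulVec, sub_eq_zero, Matrix.scalar_apply, ← Matrix.smul_one_eq_diagonal,
    Matrix.smul_mulVec, Matrix.one_mulVec, eq_comm]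

/-- A real number is a root of the characteristic polynomial if it is a left eigenvalue. -/
theorem mem_roots_charpoly_of_vecMul {k : Type*} [Fintype k] [DecidableEq k]
    (M : Matrix k k ℝ) (t : ℝ) (w : k → ℝ) (hw : w ≠ 0) (h : w ᵥ* M = t • w) :
    t ∈ M.charpoly.roots := by
  rw [← Matrix.charpoly_transpose, mem_roots_charpoly_iff_exists_mulVec]
  exact ⟨w, hw, by rw [Matrix.mulVec_transpose, h]⟩

/-- The entrywise absolute value of an eigenvector of a nonnegative matrix is subinvariant. -/
theorem mul_abs_le_mulVec_abs {k : Type*} [Fintype k] {B : Matrix k k ℝ}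
    (hB : ∀ i j, 0 ≤ B i j) {x : k → ℝ} {t : ℝ} (hx : B *ᵥ x = t • x) (i : k) :
    t * |x i| ≤ (B *ᵥ |x|) i := by
  calc t * |x i| ≤ |t| * |x i| := by gcongr; exact le_abs_self t
    _ = |(B *ᵥ x) i| := by rw [hx, Pi.smul_apply, smul_eq_mul, abs_mul]
    _ ≤ ∑ j, |B i j * x j| := Finset.abs_sum_le_sum_abs _ _
    _ = (B *ᵥ |x|) i := by
      simp only [Matrix.mulVec, dotProduct, abs_mul, abs_of_nonneg (hB _ _), Pi.abs_apply]

/-- If `0 ≤ B ≤ A` entrywise and `A` has a positive left eigenvector for `r`, then every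
real eigenvalue of `B` is at most `r`. -/
theorem eigenvalue_le_of_entrywise_le {k : Type*} [Fintype k] {A B : Matrix k k ℝ}
    (hB : ∀ i j, 0 ≤ B i j) (hBA : ∀ i j, B i j ≤ A i j) {w : k → ℝ} (hw : ∀ i, 0 < w i)
    {r : ℝ} (hA : w ᵥ* A = r • w) {x : k → ℝ} (hx0 : x ≠ 0) {t : ℝ} (hx : B *ᵥ x = t • x) :
    t ≤ r := by
  obtain ⟨j, hj⟩ := Function.ne_iff.1 hx0
  have hpos : 0 < w ⬝ᵥ |x| :=
    Finset.sum_pos' (fun i _ => mul_nonneg (hw i).le (abs_nonneg _))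
      ⟨j, Finset.mem_univ _, mul_pos (hw j) (abs_pos.2 hj)⟩
  have h₁ : w ⬝ᵥ (t • |x|) ≤ w ⬝ᵥ (B *ᵥ |x|) :=
    Finset.sum_le_sum fun i _ =>
      mul_le_mul_of_nonneg_left (mul_abs_le_mulVec_abs hB hx i) (hw i).le
  have h₂ : (w ᵥ* B) ⬝ᵥ |x| ≤ (w ᵥ* A) ⬝ᵥ |x| :=
    Finset.sum_le_sum fun i _ => mul_le_mul_of_nonneg_right
      (Finset.sum_le_sum fun l _ => mul_le_mul_of_nonneg_left (hBA l i) (hw l).le) (abs_nonneg _)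
  rw [dotProduct_smul, smul_eq_mul, Matrix.dotProduct_mulVec] at h₁
  rw [hA, smul_dotProduct, smul_eq_mul] at h₂
  exact le_of_mul_le_mul_right (h₁.trans h₂) hpos

/-- Strict form of `eigenvalue_le_of_entrywise_le`: it suffices that the inequality `B ≤ A` is
strict somewhere in column `i`, and that row `i` of `B` is positive off the diagonal. -/
theorem eigenvalue_lt_of_entrywise_le {k : Type*} [Fintype k] {A B : Matrix k k ℝ}
    (hB : ∀ i j, 0 ≤ B i j) (hBA : ∀ i j, B i j ≤ A i j) {w : k → ℝ} (hw : ∀ i, 0 < w i)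
    {r : ℝ} (hA : w ᵥ* A = r • w) {x : k → ℝ} (hx0 : x ≠ 0) {t : ℝ} (hx : B *ᵥ x = t • x)
    {i l : k} (hli : B l i < A l i) (hi : ∀ j, j ≠ i → 0 < B i j) :
    t < r := by
  refine (eigenvalue_le_of_entrywise_le hB hBA hw hA hx0 hx).lt_of_ne ?_
  rintro rfl
  have h₁ : ∀ i ∈ Finset.univ, w i * (t • |x|) i ≤ w i * (B *ᵥ |x|) i := fun i _ =>
    mul_le_mul_of_nonneg_left (mul_abs_le_mulVec_abs hB hx i) (hw i).le
  have h₂ : ∀ i ∈ Finset.univ, (w ᵥ* B) i * |x| i ≤ (w ᵥ* A) i * |x| i := fun i _ =>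
    mul_le_mul_of_nonneg_right
      (Finset.sum_le_sum fun l _ => mul_le_mul_of_nonneg_left (hBA l i) (hw l).le) (abs_nonneg _)
  have h₁' : w ⬝ᵥ (t • |x|) ≤ w ⬝ᵥ (B *ᵥ |x|) := Finset.sum_le_sum h₁
  have h₂' : (w ᵥ* B) ⬝ᵥ |x| ≤ (w ᵥ* A) ⬝ᵥ |x| := Finset.sum_le_sum h₂
  have hcomp : (w ᵥ* A) ⬝ᵥ |x| = w ⬝ᵥ (t • |x|) := by rw [hA, smul_dotProduct, dotProduct_smul]
  rw [Matrix.dotProduct_mulVec] at h₁'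
  by_cases hxi : x i = 0
  · obtain ⟨j, hj⟩ := Function.ne_iff.1 hx0
    have hji : j ≠ i := by rintro rfl; exact hj hxi
    have hrow : 0 < (B *ᵥ |x|) i :=
      Finset.sum_pos' (fun j _ => mul_nonneg (hB i j) (abs_nonneg _))
        ⟨j, Finset.mem_univ _, mul_pos (hi j hji) (abs_pos.2 hj)⟩
    have : w ⬝ᵥ (t • |x|) < w ⬝ᵥ (B *ᵥ |x|) :=
      Finset.sum_lt_sum h₁ ⟨i, Finset.mem_univ _, mul_lt_mul_of_pos_left
        (by simpa [hxi] using hrow) (hw i)⟩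
    rw [Matrix.dotProduct_mulVec] at this
    linarith
  · have hcol : (w ᵥ* B) i < (w ᵥ* A) i :=
      Finset.sum_lt_sum (fun l _ => mul_le_mul_of_nonneg_left (hBA l i) (hw l).le)
        ⟨l, Finset.mem_univ _, mul_lt_mul_of_pos_left hli (hw l)⟩
    have : (w ᵥ* B) ⬝ᵥ |x| < (w ᵥ* A) ⬝ᵥ |x| :=
      Finset.sum_lt_sum h₂ ⟨i, Finset.mem_univ _, mul_lt_mul_of_pos_right hcol (abs_pos.2 hxi)⟩
    linarith

/-- A real `2 × 2` matrix with positive off-diagonal entries has a positive eigenvector. -/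
theorem exists_pos_eigenvector_two_by_two {p q r s : ℝ} (hr : 0 < r) (hs : 0 < s) :
    ∃ a b t : ℝ, 0 < a ∧ 0 < b ∧ p * a + r * b = t * a ∧ s * a + q * b = t * b := by
  have hrs : 0 < r * s := mul_pos hr hs
  have hd : 0 ≤ (p - q) ^ 2 + 4 * (r * s) := by positivity
  have hsq := Real.sq_sqrt hd
  have hlt : p - q < √((p - q) ^ 2 + 4 * (r * s)) := Real.lt_sqrt_of_sq_lt (by linarith)
  set D := √((p - q) ^ 2 + 4 * (r * s))
  exact ⟨r, (q - p + D) / 2, (p + q + D) / 2, hr, by linarith, by ring, by linarith⟩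

theorem sum_ite_eq_zero_mul_const {k : ℕ} (i : Fin k) (a c : ℝ) :
    ∑ j : Fin k, a * (if j = i then 0 else c) = (k - 1) * c * a := by
  have : ∀ j : Fin k, a * (if j = i then 0 else c) = a * c - if j = i then a * c else 0 := by
    intro j; split_ifs <;> ring
  simp only [this, Finset.sum_sub_distrib, Finset.sum_ite_eq', Finset.mem_univ, if_true,
    Finset.sum_const, Finset.card_univ, Fintype.card_fin, nsmul_eq_mul]
  ring

theorem exists_pos_vecMul_neg_seidelS (m n : ℕ) (hm : 3 ≤ m) (hn : 3 ≤ n) :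
    ∃ (w : Fin m ⊕ Fin n → ℝ) (t : ℝ), (∀ i, 0 < w i) ∧ w ᵥ* (-seidelS m n) = t • w := by
  have hm' : (3 : ℝ) ≤ m := by exact_mod_cast hm
  have hn' : (3 : ℝ) ≤ n := by exact_mod_cast hn
  obtain ⟨a, b, t, ha, hb, h₁, h₂⟩ := exists_pos_eigenvector_two_by_two
    (p := (m - 1) * (2 * n - 1)) (q := (n - 1) * (2 * m - 1))
    (r := n * (2 * (m + n - 2) - 1)) (s := m * (2 * (m + n - 2) - 1))
    (mul_pos (by linarith) (by linarith)) (mul_pos (by linarith) (by linarith))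
  refine ⟨Sum.elim (fun _ => a) (fun _ => b), t, by simp [ha, hb], ?_⟩
  rw [Matrix.vecMul_neg]
  ext (i | i)
  · simp only [Matrix.vecMul, dotProduct, Fintype.sum_sum_type, Pi.neg_apply, Pi.smul_apply,
      Sum.elim_inl, Sum.elim_inr, seidelS, Sum.inl.injEq, sum_ite_eq_zero_mul_const, reduceCtorEq,
      if_false, Finset.sum_const, Finset.card_univ, Fintype.card_fin, nsmul_eq_mul, smul_eq_mul]
    linarith
  · simp only [Matrix.vecMul, dotProduct, Fintype.sum_sum_type, Pi.neg_apply, Pi.smul_apply,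
      Sum.elim_inl, Sum.elim_inr, seidelS, Sum.inr.injEq, sum_ite_eq_zero_mul_const, reduceCtorEq,
      if_false, Finset.sum_const, Finset.card_univ, Fintype.card_fin, nsmul_eq_mul, smul_eq_mul]
    linarith

theorem seidelS_nonpos (m n : ℕ) (hm : 3 ≤ m) (hn : 3 ≤ n) (i j : Fin m ⊕ Fin n) :
    seidelS m n i j ≤ 0 := by
  have hm' : (3 : ℝ) ≤ m := by exact_mod_cast hm
  have hn' : (3 : ℝ) ≤ n := by exact_mod_cast hn
  rcases i with i | i <;> rcases j with j | j <;> simp only [seidelS] <;> split_ifs <;> linarith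

theorem seidelS_le_seidelI (m n : ℕ) (i j : Fin m ⊕ Fin n) :
    seidelS m n i j ≤ seidelI m n i j := by
  rcases i with i | i <;> rcases j with j | j <;> simp only [seidelS, seidelI, Sum.inr.injEq,
    Fin.ext_iff, reduceCtorEq, if_false] <;> split_ifs <;> first | linarith | omega

theorem seidelI_neg (m n : ℕ) (hm : 3 ≤ m) (hn : 3 ≤ n) {i j : Fin m ⊕ Fin n} (hij : i ≠ j) :
    seidelI m n i j < 0 := by
  have hm' : (3 : ℝ) ≤ m := by exact_mod_cast hm
  have hn' : (3 : ℝ) ≤ n := by exact_mod_cast hn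
  rcases i with i | i <;> rcases j with j | j <;> simp only [seidelS, seidelI, if_neg hij] <;>
    (try split_ifs) <;> linarith

theorem seidelI_diag (m n : ℕ) (i : Fin m ⊕ Fin n) : seidelI m n i i = 0 := by
  rcases i with i | i
  · simp [seidelI, seidelS]
  · have : ¬ ((i.val = 0 ∧ i.val = 1) ∨ (i.val = 1 ∧ i.val = 0)) := by omega
    simp [seidelI, seidelS, this]

theorem stmt11 (m n : ℕ) (hm : 3 ≤ m) (hn : 3 ≤ n) :
    ∃ μ : ℝ, μ ∈ (seidelS m n).charpoly.roots ∧
      (∀ x ∈ (seidelS m n).charpoly.roots, μ ≤ x) ∧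
      (∀ y ∈ (seidelI m n).charpoly.roots, μ < y) := by
  obtain ⟨w, t, hw, ht⟩ := exists_pos_vecMul_neg_seidelS m n hm hn
  have hne : w ≠ 0 := fun h => (hw (Sum.inl ⟨0, by omega⟩)).ne' (congrFun h _)
  have hneg : ∀ {M : Matrix (Fin m ⊕ Fin n) (Fin m ⊕ Fin n) ℝ} {x : Fin m ⊕ Fin n → ℝ} {y : ℝ},
      M *ᵥ x = y • x → (-M) *ᵥ x = (-y) • x := fun h => by rw [Matrix.neg_mulVec, h, neg_smul]
  refine ⟨-t, mem_roots_charpoly_of_vecMul _ _ w hne ?_, fun y hy => ?_, fun y hy => ?_⟩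
  · rw [neg_smul, ← ht, Matrix.vecMul_neg, neg_neg]
  · obtain ⟨x, hx0, hx⟩ := (mem_roots_charpoly_iff_exists_mulVec _ _).1 hy
    exact neg_le.1 (eigenvalue_le_of_entrywise_le
      (fun i j => neg_nonneg.2 (seidelS_nonpos m n hm hn i j)) (fun _ _ => le_rfl)
      hw ht hx0 (hneg hx))
  · obtain ⟨x, hx0, hx⟩ := (mem_roots_charpoly_iff_exists_mulVec _ _).1 hy
    refine neg_lt.1 (eigenvalue_lt_of_entrywise_le (fun i j => ?_)
      (fun i j => neg_le_neg (seidelS_le_seidelI m n i j)) hw ht hx0 (hneg hx)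
      (i := Sum.inl ⟨0, by omega⟩) (l := Sum.inr ⟨0, by omega⟩) ?_
      (fun j hj => neg_pos.2 (seidelI_neg m n hm hn hj.symm)))
    · refine neg_nonneg.2 ?_
      rcases eq_or_ne i j with rfl | hij
      · exact (seidelI_diag m n i).le
      · exact (seidelI_neg m n hm hn hij).le
    · simp [seidelI, seidelS]
      norm_num
end

section
/- Let m, n ≥ 3 be integers with |m - n| ≤ 1, so that C^3_{m,n} is the 3-uniform bipartite Turán hypergraph T(m+n, 3, 2). Then deleting any single hyperedge strictly decreases the Seidel energy: the sum of the absolute values of the eigenvalues of S(m,n) strictly exceeds both the sum of the absolute values of the eigenvalues of S_I(m,n) and the sum of the absolute values of the eigenvalues of S_II(m,n). -/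
open Polynomial Matrix

theorem Matrix.IsHermitian.seidelEnergy_eq_sum_abs_eigenvalues {k : Type*} [Fintype k]
    [DecidableEq k] {M : Matrix k k ℝ} (hM : M.IsHermitian) :
    seidelEnergy M = ∑ i, |hM.eigenvalues i| := by
  simp [seidelEnergy, hM.roots_charpoly_eq_eigenvalues]

theorem seidelEnergy_reindex {k l : Type*} [Fintype k] [DecidableEq k] [Fintype l]
    [DecidableEq l] (e : k ≃ l) (M : Matrix k k ℝ) :
    seidelEnergy (Matrix.reindex e e M) = seidelEnergy M := by
  simp only [seidelEnergy, Matrix.charpoly_reindex]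

/-- Either a real symmetric matrix dominates `μ` in the Loewner order, or it has an eigenvalue
below `μ`. -/
theorem Matrix.IsHermitian.exists_eigenvalues_lt {k : Type*} [Fintype k] [DecidableEq k]
    {M : Matrix k k ℝ} (hM : M.IsHermitian) {μ : ℝ}
    (h : ¬ (M - diagonal fun _ => μ).PosSemidef) : ∃ i, hM.eigenvalues i < μ := by
  have hT : (M - diagonal fun _ => μ).IsHermitian := hM.sub (isHermitian_diagonal _)
  rw [hT.posSemidef_iff_eigenvalues_nonneg, Pi.le_def] at h
  push Not at h
  obtain ⟨j, hj⟩ := h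
  have hv := hT.mulVec_eigenvectorBasis j
  set ν := hT.eigenvalues j
  set v : k → ℝ := ⇑(hT.eigenvectorBasis j)
  have hv0 : v ≠ 0 := by
    intro h0
    apply hT.eigenvectorBasis.orthonormal.ne_zero j
    ext i
    exact congrFun h0 i
  have hroot : M.charpoly.IsRoot (ν + μ) := by
    rw [Polynomial.IsRoot, Matrix.eval_charpoly, ← Matrix.exists_mulVec_eq_zero_iff]
    refine ⟨v, hv0, ?_⟩
    ext i
    have := congrFun hv i
    simp only [Matrix.sub_mulVec, Matrix.mulVec_diagonal, Pi.sub_apply, Pi.smul_apply,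
      smul_eq_mul, Matrix.scalar_apply, Pi.zero_apply] at this ⊢
    linarith
  have hmem : ν + μ ∈ M.charpoly.roots :=
    (Polynomial.mem_roots M.charpoly_monic.ne_zero).2 hroot
  rw [hM.roots_charpoly_eq_eigenvalues] at hmem
  obtain ⟨i, -, hi⟩ := Multiset.mem_map.1 hmem
  refine ⟨i, ?_⟩
  simp only [Function.comp_apply, RCLike.ofReal_real_eq_id, id] at hi
  simp only [Pi.zero_apply] at hj
  linarith

/-- In a traceless symmetric matrix, every eigenvalue accounts for at most half of the energy. -/
theorem Matrix.IsHermitian.neg_two_mul_eigenvalues_le_seidelEnergy {k : Type*} [Fintype k]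
    [DecidableEq k] {M : Matrix k k ℝ} (hM : M.IsHermitian) (h0 : M.trace = 0) (i : k) :
    -2 * hM.eigenvalues i ≤ seidelEnergy M := by
  have ht : ∑ j, hM.eigenvalues j = 0 := by
    simpa [h0] using hM.trace_eq_sum_eigenvalues.symm
  rw [hM.seidelEnergy_eq_sum_abs_eigenvalues]
  rw [← Finset.add_sum_erase _ _ (Finset.mem_univ i)] at ht ⊢
  have h1 := Finset.sum_le_sum fun j (_ : j ∈ Finset.univ.erase i) =>
    le_abs_self (hM.eigenvalues j)
  linarith [neg_abs_le (hM.eigenvalues i)]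

/-- A symmetric matrix which is positive semidefinite up to a rank-one term has at most one
negative eigenvalue. -/
theorem Matrix.IsHermitian.eigenvalues_nonneg_of_rank_one_perturbation {k : Type*} [Fintype k]
    [DecidableEq k] {M : Matrix k k ℝ} (hM : M.IsHermitian) {r : ℝ} {l : k → ℝ}
    (h : (M - r • vecMulVec l l).PosSemidef) {i j : k} (hij : i ≠ j)
    (hi : hM.eigenvalues i < 0) : 0 ≤ hM.eigenvalues j := by
  by_contra! hj
  have key : ∀ v : k → ℝ, l ⬝ᵥ v = 0 → 0 ≤ v ⬝ᵥ M *ᵥ v := by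
    intro v hv
    have := h.dotProduct_mulVec_nonneg v
    simpa [Matrix.sub_mulVec, Matrix.smul_mulVec, Matrix.vecMulVec_mulVec, hv] using this
  have hor := hM.eigenvectorBasis.orthonormal
  have hu := hM.mulVec_eigenvectorBasis i
  have hw := hM.mulVec_eigenvectorBasis j
  have huu : (⇑(hM.eigenvectorBasis i) : k → ℝ) ⬝ᵥ ⇑(hM.eigenvectorBasis i) = 1 := by
    have := orthonormal_iff_ite.1 hor i i
    rwa [EuclideanSpace.inner_eq_star_dotProduct, star_trivial, if_pos rfl] at this
  have hww : (⇑(hM.eigenvectorBasis j) : k → ℝ) ⬝ᵥ ⇑(hM.eigenvectorBasis j) = 1 := by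
    have := orthonormal_iff_ite.1 hor j j
    rwa [EuclideanSpace.inner_eq_star_dotProduct, star_trivial, if_pos rfl] at this
  have huw : (⇑(hM.eigenvectorBasis i) : k → ℝ) ⬝ᵥ ⇑(hM.eigenvectorBasis j) = 0 := by
    have := orthonormal_iff_ite.1 hor j i
    rwa [EuclideanSpace.inner_eq_star_dotProduct, star_trivial, if_neg hij.symm] at this
  generalize (⇑(hM.eigenvectorBasis i) : k → ℝ) = u at *
  generalize (⇑(hM.eigenvectorBasis j) : k → ℝ) = w at *
  by_cases hlu : l ⬝ᵥ u = 0
  · have := key u hlu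
    rw [hu, dotProduct_smul, huu, smul_eq_mul] at this
    linarith
  · have := key ((l ⬝ᵥ w) • u - (l ⬝ᵥ u) • w)
      (by simp only [dotProduct_sub, dotProduct_smul, smul_eq_mul]; ring)
    simp only [Matrix.mulVec_sub, Matrix.mulVec_smul, hu, hw, dotProduct_sub, sub_dotProduct,
      dotProduct_smul, smul_dotProduct, smul_eq_mul, huu, hww, huw,
      dotProduct_comm w u] at this
    nlinarith [sq_nonneg (l ⬝ᵥ w), sq_pos_of_ne_zero hlu,
      mul_nonneg (sq_nonneg (l ⬝ᵥ w)) (neg_nonneg.2 hi.le),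
      mul_pos (sq_pos_of_ne_zero hlu) (neg_pos.2 hj)]

theorem dotProduct_mulVec_eq_sum {k : Type*} [Fintype k] (M : Matrix k k ℝ) (x : k → ℝ) :
    x ⬝ᵥ M *ᵥ x = ∑ i, ∑ j, x i * M i j * x j := by
  simp only [dotProduct, Matrix.mulVec, Finset.mul_sum, mul_assoc]

/-- Perron–Frobenius comparison: if `S` has zero diagonal and negative off-diagonal entries, and
`A ≥ S` entrywise with a strict inequality somewhere, then the quadratic form of `S - μ` cannot be
positive semidefinite once `A` has a nonzero nonnegative vector of Rayleigh quotient at most `μ`. -/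
theorem not_posSemidef_sub_of_entrywise_lt {k : Type*} [Fintype k] [DecidableEq k]
    {A S : Matrix k k ℝ} (hdiag : ∀ i, S i i = 0) (hneg : ∀ i j, i ≠ j → S i j < 0)
    (hle : ∀ i j, S i j ≤ A i j) {p q : k} (hpq : p ≠ q) (hlt : S p q < A p q)
    {μ : ℝ} {y : k → ℝ} (hy : ∀ i, 0 ≤ y i) (hy0 : y ≠ 0)
    (hyA : y ⬝ᵥ A *ᵥ y ≤ μ * (y ⬝ᵥ y)) : ¬ (S - diagonal fun _ => μ).PosSemidef := by
  intro hpsd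
  have hform : y ⬝ᵥ (S - diagonal fun _ => μ) *ᵥ y = y ⬝ᵥ S *ᵥ y - μ * (y ⬝ᵥ y) := by
    have : (diagonal fun _ => μ) *ᵥ y = μ • y := by
      ext i; simp [Matrix.mulVec_diagonal]
    rw [Matrix.sub_mulVec, dotProduct_sub, this, dotProduct_smul, smul_eq_mul]
  have hterm : ∀ i j, y i * S i j * y j ≤ y i * A i j * y j := fun i j =>
    mul_le_mul_of_nonneg_right (mul_le_mul_of_nonneg_left (hle i j) (hy i)) (hy j)
  have hSA : y ⬝ᵥ S *ᵥ y ≤ y ⬝ᵥ A *ᵥ y := by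
    rw [dotProduct_mulVec_eq_sum, dotProduct_mulVec_eq_sum]
    exact Finset.sum_le_sum fun i _ => Finset.sum_le_sum fun j _ => hterm i j
  have hnn := hpsd.dotProduct_mulVec_nonneg y
  rw [star_trivial, hform] at hnn
  have hzero : (S - diagonal fun _ => μ) *ᵥ y = 0 := by
    rw [← hpsd.dotProduct_mulVec_zero_iff, star_trivial, hform]
    linarith
  have hSy : ∀ j, ∑ i, S j i * y i = μ * y j := by
    intro j
    have := congrFun hzero j
    rw [Matrix.sub_mulVec, Pi.sub_apply, Matrix.mulVec_diagonal, Pi.zero_apply, sub_eq_zero] at this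
    exact this
  have hspread : ∀ i j, i ≠ j → 0 < y i → 0 < y j := by
    intro i j hij hi
    refine lt_of_le_of_ne (hy j) fun h => ?_
    have h1 : ∑ i, S j i * y i < 0 := by
      refine Finset.sum_neg' (fun t _ => ?_) ⟨i, Finset.mem_univ i, ?_⟩
      · rcases eq_or_ne j t with rfl | ht
        · simp [hdiag]
        · exact mul_nonpos_of_nonpos_of_nonneg (hneg j t ht).le (hy t)
      · exact mul_neg_of_neg_of_pos (hneg j i hij.symm) hi
    rw [hSy, ← h, mul_zero] at h1
    exact lt_irrefl _ h1
  obtain ⟨i, hi⟩ := Function.ne_iff.1 hy0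
  have hi' : 0 < y i := lt_of_le_of_ne (hy i) (Ne.symm hi)
  have hp : 0 < y p ∧ 0 < y q := by
    rcases eq_or_ne i p with rfl | hip
    · exact ⟨hi', hspread _ _ hpq hi'⟩
    · have := hspread i p hip hi'
      exact ⟨this, hspread _ _ hpq this⟩
  have hSA' : y ⬝ᵥ S *ᵥ y < y ⬝ᵥ A *ᵥ y := by
    rw [dotProduct_mulVec_eq_sum, dotProduct_mulVec_eq_sum]
    refine Finset.sum_lt_sum (fun i _ => Finset.sum_le_sum fun j _ => hterm i j)
      ⟨p, Finset.mem_univ p, Finset.sum_lt_sum (fun j _ => hterm p j) ⟨q, Finset.mem_univ q, ?_⟩⟩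
    exact mul_lt_mul_of_pos_right (mul_lt_mul_of_pos_left hlt hp.1) hp.2
  linarith

/-- Raising entries of a hollow matrix with negative off-diagonal entries strictly decreases the
energy, provided the entries stay nonpositive and the new matrix is positive semidefinite up to a
rank-one term. -/
theorem seidelEnergy_lt_of_entrywise_lt {k : Type*} [Fintype k] [DecidableEq k]
    {A S : Matrix k k ℝ} (hS : S.IsHermitian) (hA : A.IsHermitian)
    (hdiag : ∀ i, S i i = 0) (hneg : ∀ i j, i ≠ j → S i j < 0)
    (hAdiag : ∀ i, A i i = 0) (hAneg : ∀ i j, A i j ≤ 0)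
    (hle : ∀ i j, S i j ≤ A i j) {p q : k} (hpq : p ≠ q) (hlt : S p q < A p q)
    {r : ℝ} {l : k → ℝ} (h : (A - r • vecMulVec l l).PosSemidef) :
    seidelEnergy A < seidelEnergy S := by
  have htS : S.trace = 0 := Finset.sum_eq_zero fun i _ => hdiag i
  have htA : A.trace = 0 := Finset.sum_eq_zero fun i _ => hAdiag i
  have ht : ∑ j, hA.eigenvalues j = 0 := by
    simpa [htA] using hA.trace_eq_sum_eigenvalues.symm
  suffices H : ∃ μ, seidelEnergy A = -2 * μ ∧ ∃ y : k → ℝ, (∀ i, 0 ≤ y i) ∧ y ≠ 0 ∧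
      y ⬝ᵥ A *ᵥ y ≤ μ * (y ⬝ᵥ y) by
    obtain ⟨μ, hE, y, hy, hy0, hyA⟩ := H
    obtain ⟨i, hi⟩ := hS.exists_eigenvalues_lt
      (not_posSemidef_sub_of_entrywise_lt hdiag hneg hle hpq hlt hy hy0 hyA)
    have := hS.neg_two_mul_eigenvalues_le_seidelEnergy htS i
    linarith
  rw [hA.seidelEnergy_eq_sum_abs_eigenvalues]
  by_cases hex : ∃ i, hA.eigenvalues i < 0
  · obtain ⟨i, hi⟩ := hex
    have hv := hA.mulVec_eigenvectorBasis i
    have hv0 : (⇑(hA.eigenvectorBasis i) : k → ℝ) ≠ 0 := by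
      intro h0
      apply hA.eigenvectorBasis.orthonormal.ne_zero i
      ext t
      exact congrFun h0 t
    generalize (⇑(hA.eigenvectorBasis i) : k → ℝ) = x at *
    refine ⟨hA.eigenvalues i, ?_, fun t => |x t|, fun t => abs_nonneg _, ?_, ?_⟩
    · rw [← Finset.add_sum_erase _ _ (Finset.mem_univ i)] at ht ⊢
      rw [Finset.sum_congr rfl fun j hj => abs_of_nonneg
        (hA.eigenvalues_nonneg_of_rank_one_perturbation h (Finset.ne_of_mem_erase hj).symm hi),
        abs_of_neg hi]
      linarith
    · intro h0
      exact hv0 (funext fun t => abs_eq_zero.1 (congrFun h0 t))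
    · have h1 : x ⬝ᵥ A *ᵥ x = hA.eigenvalues i * (x ⬝ᵥ x) := by
        rw [hv, dotProduct_smul, smul_eq_mul]
      have h2 : (fun t => |x t|) ⬝ᵥ (fun t => |x t|) = x ⬝ᵥ x := by
        simp [dotProduct]
      rw [h2, ← h1, dotProduct_mulVec_eq_sum, dotProduct_mulVec_eq_sum]
      refine Finset.sum_le_sum fun s _ => Finset.sum_le_sum fun t _ => ?_
      have h3 : x s * x t ≤ |x s| * |x t| := by
        rw [← abs_mul]; exact le_abs_self _
      nlinarith [mul_le_mul_of_nonpos_left h3 (hAneg s t)]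
  · push Not at hex
    refine ⟨0, ?_, Pi.single p 1, ?_, ?_, ?_⟩
    · rw [Finset.sum_congr rfl fun j _ => abs_of_nonneg (hex j), ht]; simp
    · intro t
      by_cases htp : t = p
      · subst htp; simp
      · simp [htp]
    · simp
    · simp [hAdiag]

theorem seidelEnergy_seidelI_lt (m n : ℕ) (hm : 3 ≤ m) (hn : 3 ≤ n) :
    seidelEnergy (seidelI m n) < seidelEnergy (seidelS m n) := by
  have hm' : (3 : ℝ) ≤ m := by exact_mod_cast hm
  have hn' : (3 : ℝ) ≤ n := by exact_mod_cast hn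
  have hS : (seidelS m n).IsHermitian := by
    ext i j
    rcases i with i | i <;> rcases j with j | j <;> simp [seidelS, eq_comm]
  have hA : (seidelI m n).IsHermitian := by
    ext i j
    rcases i with i | i <;> rcases j with j | j <;>
      simp [seidelI, seidelS, eq_comm, or_comm, and_comm]
  have hle : ∀ i j, seidelS m n i j ≤ seidelI m n i j := by
    rintro (i | i) (j | j) <;> simp only [seidelI] <;> try split_ifs
    all_goals first | exact le_rfl | skip
    all_goals simp only [seidelS, reduceCtorEq, if_false]
    all_goals try linarith
    split_ifs <;> first | linarith | skip
    exfalso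
    simp_all only [Sum.inr.injEq]
    omega
  have hlt : seidelS m n (Sum.inl ⟨0, by omega⟩) (Sum.inr ⟨0, by omega⟩) <
      seidelI m n (Sum.inl ⟨0, by omega⟩) (Sum.inr ⟨0, by omega⟩) := by
    simp only [seidelI, seidelS, reduceCtorEq, if_false, zero_le_one, and_self, if_true]
    linarith
  set a : ℝ := 1 - 2 * n with ha
  set b : ℝ := 1 - 2 * m with hb
  set c : ℝ := 1 - 2 * (m + n - 2) with hc
  have ha0 : a < 0 := by linarith
  let l : Fin m ⊕ Fin n → ℝ := Sum.elim (fun _ => a) (fun _ => c)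
  let w : Fin m ⊕ Fin n → ℝ :=
    Sum.elim (fun i => if i.val = 0 then 1 else 0) (fun i => if i.val ≤ 1 then 1 else 0)
  let τ : Fin m ⊕ Fin n → ℝ := Sum.elim (fun _ => 0) (fun _ => 1)
  let e : Fin m ⊕ Fin n → ℝ := fun i => Sum.elim (fun _ => -a) (fun _ => -b) i - 2 * w i
  have hdecomp : seidelI m n - a⁻¹ • vecMulVec l l =
      diagonal e + (b - c ^ 2 / a) • vecMulVec τ τ + (2 : ℝ) • vecMulVec w w := by
    have haa : a⁻¹ * (a * a) = a := inv_mul_cancel_left₀ ha0.ne a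
    have hac : a⁻¹ * (a * c) = c := inv_mul_cancel_left₀ ha0.ne c
    have hca : a⁻¹ * (c * a) = c := by rw [mul_comm c, hac]
    ext i j
    rcases i with i | i <;> rcases j with j | j
    all_goals
      simp only [seidelI, seidelS, l, τ, w, e, Matrix.sub_apply, Matrix.add_apply,
        Matrix.smul_apply, vecMulVec_apply, diagonal_apply, Sum.elim_inl, Sum.elim_inr,
        smul_eq_mul, Sum.inl.injEq, Sum.inr.injEq, Fin.ext_iff, reduceCtorEq, if_false,
        haa, hac, hca]
    all_goals split_ifs
    all_goals first | (exfalso; omega) | skip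
    all_goals simp only [ha, hb, hc]
    all_goals ring
  refine seidelEnergy_lt_of_entrywise_lt hS hA ?_ ?_ ?_ ?_ hle (by simp) hlt
    (r := a⁻¹) (l := l) ?_
  · intro i; simp [seidelS]
  · rintro (i | i) (j | j) hij <;> simp only [seidelS, hij, if_false] <;> linarith
  · rintro (i | i) <;> simp [seidelI, seidelS] <;> omega
  · rintro (i | i) (j | j) <;> simp only [seidelI, seidelS] <;> split_ifs <;> linarith
  · rw [hdecomp]
    have hκ : 0 ≤ b - c ^ 2 / a := by
      rw [sub_nonneg, div_le_iff_of_neg ha0]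
      nlinarith
    have hpsd : ∀ v : Fin m ⊕ Fin n → ℝ, (vecMulVec v v).PosSemidef := fun v => by
      simpa using posSemidef_vecMulVec_self_star v
    refine ((PosSemidef.diagonal ?_).add ((hpsd τ).smul hκ)).add ((hpsd w).smul zero_le_two)
    rintro (i | i) <;> simp only [e, w, Sum.elim_inl, Sum.elim_inr, Pi.zero_apply] <;>
      split_ifs <;> linarith

theorem seidelII_eq_reindex (m n : ℕ) :
    seidelII m n = Matrix.reindex (Equiv.sumComm _ _) (Equiv.sumComm _ _) (seidelI n m) := by
  ext i j
  rcases i with i | i <;> rcases j with j | j <;>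
    simp [seidelII, seidelI, seidelS, and_comm, add_comm]

theorem seidelS_eq_reindex (m n : ℕ) :
    seidelS m n = Matrix.reindex (Equiv.sumComm _ _) (Equiv.sumComm _ _) (seidelS n m) := by
  ext i j
  rcases i with i | i <;> rcases j with j | j <;> simp [seidelS, add_comm]

theorem stmt15 (m n : ℕ) (hm : 3 ≤ m) (hn : 3 ≤ n)
    (hbal : |(m : ℤ) - (n : ℤ)| ≤ 1) :
    seidelEnergy (seidelI m n) < seidelEnergy (seidelS m n) ∧
    seidelEnergy (seidelII m n) < seidelEnergy (seidelS m n) := by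
  refine ⟨seidelEnergy_seidelI_lt m n hm hn, ?_⟩
  rw [seidelII_eq_reindex, seidelS_eq_reindex, seidelEnergy_reindex, seidelEnergy_reindex]
  exact seidelEnergy_seidelI_lt n m hn hm
end
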